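/- For an ergodic dynamical system (X, T, μ) and any grid θ, the box dimensions satisfy: Δ_τ^±(θ,q) ≥ Δ_μ^±(θ,q) for q < 0; Δ_τ^±(θ,q) ≤ Δ_μ^±(θ,q) for q > 0; and Δ_τ^±(θ,0) = Δ_μ^±(θ,0). -/

import Mathlib

open MeasureTheory Filter Set
open scoped ENNReal Topology NNReal

noncomputable section

/-- First return time of `x` to the set `A` under the map `T`;
by convention it is `0` if the orbit of `x` never returns to `A`. -/
def firstReturn {α : Type*} (T : α → α) (A : Set α) (x : α) : ℕ :=
  sInf {k : ℕ | 0 < k ∧ T^[k] x ∈ A}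

/-- Extended logarithm `ℝ≥0∞ → EReal`. -/
def elog (x : ℝ≥0∞) : EReal :=
  if x = 0 then ⊥ else if x = ⊤ then ⊤ else ((Real.log x.toReal : ℝ) : EReal)

section Generic

variable {α : Type*} [MeasurableSpace α] [PseudoMetricSpace α]

/-- The measure partition function `Γ_μ(ε,q)`. -/
def measPF (μ : Measure α) (ε q : ℝ) : ℝ≥0∞ :=
  ∫⁻ x, μ (Metric.ball x ε) ^ (q - 1) ∂μ

/-- The logarithmic measure partition function `Γ^l_μ(ε)`. -/
def measPFlog (μ : Measure α) (ε : ℝ) : ℝ :=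
  ∫ x, Real.log (μ (Metric.ball x ε)).toReal ∂μ

/-- The return time partition function `Γ_τ(ε,q)`. -/
def retPF (T : α → α) (μ : Measure α) (ε q : ℝ) : ℝ≥0∞ :=
  ∫⁻ x, (firstReturn T (Metric.ball x ε) x : ℝ≥0∞) ^ (1 - q) ∂μ

/-- The logarithmic return time partition function `Γ^l_τ(ε)`. -/
def retPFlog (T : α → α) (μ : Measure α) (ε : ℝ) : ℝ :=
  ∫ x, Real.log ((firstReturn T (Metric.ball x ε) x : ℝ))⁻¹ ∂μ

/-- The scaling exponent `(1/(q-1)) · log F(ε) / log ε`. -/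
def dimScale (F : ℝ → ℝ≥0∞) (q : ℝ) (ε : ℝ) : EReal :=
  ((((q - 1) * Real.log ε)⁻¹ : ℝ) : EReal) * elog (F ε)

/-- Upper generalized dimension obtained from a one-parameter family of partition
functions `F ε`, with the logarithmic convention at `q = 1`. -/
def dimPlus (F : ℝ → ℝ≥0∞) (Flog : ℝ → ℝ) (q : ℝ) : EReal :=
  if q = 1 then ((limsup (fun ε => Flog ε / Real.log ε) (𝓝[>] (0:ℝ)) : ℝ) : EReal)
  else limsup (dimScale F q) (𝓝[>] (0:ℝ))

/-- Lower generalized dimension. -/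
def dimMinus (F : ℝ → ℝ≥0∞) (Flog : ℝ → ℝ) (q : ℝ) : EReal :=
  if q = 1 then ((liminf (fun ε => Flog ε / Real.log ε) (𝓝[>] (0:ℝ)) : ℝ) : EReal)
  else liminf (dimScale F q) (𝓝[>] (0:ℝ))

/-- Generalized measure dimensions `D_μ^+(q)`. -/
def DmuPlus (μ : Measure α) (q : ℝ) : EReal :=
  dimPlus (fun ε => measPF μ ε q) (measPFlog μ) q

/-- Generalized measure dimensions `D_μ^-(q)`. -/
def DmuMinus (μ : Measure α) (q : ℝ) : EReal :=
  dimMinus (fun ε => measPF μ ε q) (measPFlog μ) q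

/-- Return time generalized dimensions `D_τ^+(q)`. -/
def DtauPlus (T : α → α) (μ : Measure α) (q : ℝ) : EReal :=
  dimPlus (fun ε => retPF T μ ε q) (retPFlog T μ) q

/-- Return time generalized dimensions `D_τ^-(q)`. -/
def DtauMinus (T : α → α) (μ : Measure α) (q : ℝ) : EReal :=
  dimMinus (fun ε => retPF T μ ε q) (retPFlog T μ) q

end Generic

/-- Euclidean space `ℝ^n`. -/
abbrev Euc (n : ℕ) := EuclideanSpace ℝ (Fin n)

/-- A grid in `ℝ^n` : a choice of origin and orientation, determining for every
side length `ε` a partition of `ℝ^n` into half-open cubes of side `ε`. -/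
structure Grid (n : ℕ) where
  origin : Euc n
  rot : Euc n ≃ₗᵢ[ℝ] Euc n

/-- Coordinates of a point w.r.t. a grid. -/
def Grid.coords {n : ℕ} (θ : Grid n) (x : Euc n) : Fin n → ℝ :=
  fun i => θ.rot.symm (x - θ.origin) i

/-- The cube `A_j` of side `ε` of the grid `θ`, indexed by `j : Fin n → ℤ`. -/
def Grid.box {n : ℕ} (θ : Grid n) (ε : ℝ) (j : Fin n → ℤ) : Set (Euc n) :=
  {x | ∀ i, (j i : ℝ) * ε ≤ θ.coords x i ∧ θ.coords x i < ((j i : ℝ) + 1) * ε}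

/-- The enlarged cube `Ā_j` of side `3ε` concentric with `A_j`. -/
def Grid.bigBox {n : ℕ} (θ : Grid n) (ε : ℝ) (j : Fin n → ℤ) : Set (Euc n) :=
  {x | ∀ i, ((j i : ℝ) - 1) * ε ≤ θ.coords x i ∧ θ.coords x i < ((j i : ℝ) + 2) * ε}

/-- Box measure partition function `Υ_μ(θ,ε,q) = Σ_{μ(A_j)>0} μ(A_j)^q`. -/
def boxMeasPF {n : ℕ} (μ : Measure (Euc n)) (θ : Grid n) (ε q : ℝ) : ℝ≥0∞ :=
  ∑' j : Fin n → ℤ, if μ (θ.box ε j) = 0 then 0 else μ (θ.box ε j) ^ q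

/-- Logarithmic box measure partition function `Υ^l_μ(θ,ε)`. -/
def boxMeasPFlog {n : ℕ} (μ : Measure (Euc n)) (θ : Grid n) (ε : ℝ) : ℝ :=
  ∑' j : Fin n → ℤ, (μ (θ.box ε j)).toReal * Real.log (μ (θ.box ε j)).toReal

/-- Return time box partition function `Υ_τ(θ,ε,q)`. -/
def boxRetPF {n : ℕ} (T : Euc n → Euc n) (μ : Measure (Euc n)) (θ : Grid n)
    (ε q : ℝ) : ℝ≥0∞ :=
  ∑' j : Fin n → ℤ, ∫⁻ x in θ.box ε j,
    (firstReturn T (θ.box ε j) x : ℝ≥0∞) ^ (1 - q) ∂μ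

/-- Logarithmic return time box partition function `Υ^l_τ(θ,ε)`. -/
def boxRetPFlog {n : ℕ} (T : Euc n → Euc n) (μ : Measure (Euc n)) (θ : Grid n)
    (ε : ℝ) : ℝ :=
  ∑' j : Fin n → ℤ, ∫ x in θ.box ε j,
    Real.log ((firstReturn T (θ.box ε j) x : ℝ))⁻¹ ∂μ

/-- Riedi's enhanced box partition function `Φ_μ(θ,ε,q)`. -/
def riediPF {n : ℕ} (μ : Measure (Euc n)) (θ : Grid n) (ε q : ℝ) : ℝ≥0∞ :=
  ∑' j : Fin n → ℤ, if μ (θ.box ε j) = 0 then 0 else μ (θ.bigBox ε j) ^ q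

/-- The enhanced box partition function `Ψ_μ(θ,ε,q) = Σ_{μ(A_j)>0} μ(A_j) μ(Ā_j)^{q-1}`. -/
def psiMeasPF {n : ℕ} (μ : Measure (Euc n)) (θ : Grid n) (ε q : ℝ) : ℝ≥0∞ :=
  ∑' j : Fin n → ℤ,
    if μ (θ.box ε j) = 0 then 0 else μ (θ.box ε j) * μ (θ.bigBox ε j) ^ (q - 1)

/-- The logarithmic enhanced box partition function `Ψ^l_μ(θ,ε)`. -/
def psiMeasPFlog {n : ℕ} (μ : Measure (Euc n)) (θ : Grid n) (ε : ℝ) : ℝ :=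
  ∑' j : Fin n → ℤ, (μ (θ.box ε j)).toReal * Real.log (μ (θ.bigBox ε j)).toReal

/-- The enhanced return time box partition function `Ψ_τ(θ,ε,q)`:
the integral is over `A_j` but the return is to the enlarged box `Ā_j`. -/
def psiRetPF {n : ℕ} (T : Euc n → Euc n) (μ : Measure (Euc n)) (θ : Grid n)
    (ε q : ℝ) : ℝ≥0∞ :=
  ∑' j : Fin n → ℤ, ∫⁻ x in θ.box ε j,
    (firstReturn T (θ.bigBox ε j) x : ℝ≥0∞) ^ (1 - q) ∂μ

/-- Box measure dimensions `Δ_μ^+(θ,q)`. -/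
def DeltaMuPlus {n : ℕ} (μ : Measure (Euc n)) (θ : Grid n) (q : ℝ) : EReal :=
  dimPlus (fun ε => boxMeasPF μ θ ε q) (boxMeasPFlog μ θ) q

/-- Box measure dimensions `Δ_μ^-(θ,q)`. -/
def DeltaMuMinus {n : ℕ} (μ : Measure (Euc n)) (θ : Grid n) (q : ℝ) : EReal :=
  dimMinus (fun ε => boxMeasPF μ θ ε q) (boxMeasPFlog μ θ) q

/-- Box return time dimensions `Δ_τ^+(θ,q)`. -/
def DeltaTauPlus {n : ℕ} (T : Euc n → Euc n) (μ : Measure (Euc n)) (θ : Grid n)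
    (q : ℝ) : EReal :=
  dimPlus (fun ε => boxRetPF T μ θ ε q) (boxRetPFlog T μ θ) q

/-- Box return time dimensions `Δ_τ^-(θ,q)`. -/
def DeltaTauMinus {n : ℕ} (T : Euc n → Euc n) (μ : Measure (Euc n)) (θ : Grid n)
    (q : ℝ) : EReal :=
  dimMinus (fun ε => boxRetPF T μ θ ε q) (boxRetPFlog T μ θ) q

end

/-! ### Kac's lemma -/

section Kac

variable {α : Type*} {T : α → α} {A : Set α}

/-- Points whose first `k` iterates, starting from the point itself, avoid `A`. -/
def avoid (T : α → α) (A : Set α) (k : ℕ) : Set α :=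
  {x | ∀ i < k, T^[i] x ∉ A}

/-- Points with a strictly positive iterate in `A`. -/
def returning (T : α → α) (A : Set α) : Set α :=
  {x | ∃ k, 0 < k ∧ T^[k] x ∈ A}

lemma lt_firstReturn_iff {x : α} (hx : x ∈ returning T A) (k : ℕ) :
    k < firstReturn T A x ↔ T x ∈ avoid T A k := by
  have hne : {k : ℕ | 0 < k ∧ T^[k] x ∈ A}.Nonempty := hx
  constructor
  · intro h i hi hmem
    have : firstReturn T A x ≤ i + 1 := Nat.sInf_le ⟨by omega, by simpa using hmem⟩
    omega
  · intro h
    by_contra! hk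
    obtain ⟨hpos, hmem⟩ : 0 < firstReturn T A x ∧ T^[firstReturn T A x] x ∈ A :=
      Nat.sInf_mem hne
    obtain ⟨m, hm⟩ := Nat.exists_eq_succ_of_ne_zero hpos.ne'
    rw [hm] at hmem hk
    exact h m (by omega) (by simpa using hmem)

lemma firstReturn_eq_zero {x : α} (hx : x ∉ returning T A) : firstReturn T A x = 0 := by
  have : {k : ℕ | 0 < k ∧ T^[k] x ∈ A} = ∅ := Set.not_nonempty_iff_eq_empty.1 hx
  rw [firstReturn, this, Nat.sInf_empty]

lemma firstReturn_pos {x : α} (hx : x ∈ returning T A) : 0 < firstReturn T A x :=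
  (lt_firstReturn_iff hx 0).2 fun i hi => absurd hi (Nat.not_lt_zero i)

lemma avoid_succ (k : ℕ) : avoid T A (k + 1) = (T ⁻¹' avoid T A k) \ A := by
  ext x
  constructor
  · intro h
    exact ⟨fun i hi => by simpa using h (i + 1) (by omega), h 0 (by omega)⟩
  · rintro ⟨h, h0⟩ i hi
    cases i with
    | zero => exact h0
    | succ i => simpa using h i (by omega)

lemma compl_returning : (returning T A)ᶜ = T ⁻¹' ⋂ k, avoid T A k := by
  ext x
  simp only [returning, mem_compl_iff, mem_ofPred_eq, not_exists, not_and, mem_preimage, mem_iInter,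
    avoid]
  constructor
  · intro h k i _
    simpa using h (i + 1) (by omega)
  · intro h k hk
    obtain ⟨m, rfl⟩ := Nat.exists_eq_succ_of_ne_zero hk.ne'
    simpa using h (m + 1) m (by omega)

variable [MeasurableSpace α]

lemma measurableSet_avoid (hT : Measurable T) (hA : MeasurableSet A) (k : ℕ) :
    MeasurableSet (avoid T A k) := by
  have : avoid T A k = ⋂ i, ⋂ (_ : i < k), (T^[i] ⁻¹' A)ᶜ := by
    ext x; simp [avoid]
  rw [this]
  exact MeasurableSet.iInter fun i => MeasurableSet.iInter fun _ => (hT.iterate i hA).compl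

lemma measurableSet_returning (hT : Measurable T) (hA : MeasurableSet A) :
    MeasurableSet (returning T A) := by
  rw [← compl_compl (returning T A), compl_returning]
  exact (hT (MeasurableSet.iInter fun k => measurableSet_avoid hT hA k)).compl

lemma measurable_firstReturn (hT : Measurable T) (hA : MeasurableSet A) :
    Measurable (firstReturn T A) := by
  refine measurable_of_Ioi fun k => ?_
  have : firstReturn T A ⁻¹' Ioi k = returning T A ∩ T ⁻¹' avoid T A k := by
    ext x
    by_cases hx : x ∈ returning T A
    · simp [hx, lt_firstReturn_iff hx]
    · simp [hx, firstReturn_eq_zero hx]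
  rw [this]
  exact (measurableSet_returning hT hA).inter (hT (measurableSet_avoid hT hA k))

variable {μ : Measure α} [IsProbabilityMeasure μ]

lemma measure_iInter_avoid (hT : Ergodic T μ) (hA : MeasurableSet A) (h0 : μ A ≠ 0) :
    μ (⋂ k, avoid T A k) = 0 := by
  have hm : MeasurableSet (⋂ k, avoid T A k) :=
    MeasurableSet.iInter fun k => measurableSet_avoid hT.measurable hA k
  have hsub : (⋂ k, avoid T A k) ⊆ T ⁻¹' ⋂ k, avoid T A k := by
    intro x hx
    simp only [mem_preimage, mem_iInter] at hx ⊢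
    intro k
    have := hx (k + 1)
    rw [avoid_succ] at this
    exact this.1
  rcases hT.ae_empty_or_univ_of_ae_le_preimage hm.nullMeasurableSet hsub.eventuallyLE with h | h
  · simpa using measure_congr h
  · exfalso
    apply h0
    have hc : μ (⋂ k, avoid T A k)ᶜ = 0 := by
      rw [ae_eq_univ] at h
      exact h
    have hsub' : A ⊆ (⋂ k, avoid T A k)ᶜ := by
      intro x hx hx'
      exact mem_iInter.1 hx' 1 0 (by omega) hx
    exact measure_mono_null hsub' hc

lemma ae_mem_returning (hT : Ergodic T μ) (hA : MeasurableSet A) (h0 : μ A ≠ 0) :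
    ∀ᵐ x ∂μ, x ∈ returning T A := by
  change μ (returning T A)ᶜ = 0
  rw [compl_returning, hT.measure_preimage
    (MeasurableSet.iInter fun k => measurableSet_avoid hT.measurable hA k).nullMeasurableSet,
    measure_iInter_avoid hT hA h0]

/-- **Kac's lemma**: the mean return time to `A`, unnormalized, is one. -/
theorem lintegral_firstReturn (hT : Ergodic T μ) (hA : MeasurableSet A) (h0 : μ A ≠ 0) :
    ∫⁻ x in A, (firstReturn T A x : ℝ≥0∞) ∂μ = 1 := by
  have hav := measurableSet_avoid (T := T) hT.measurable hA
  have hcount : ∀ x ∈ returning T A, (firstReturn T A x : ℝ≥0∞)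
      = ∑' k, (T ⁻¹' avoid T A k).indicator 1 x := by
    intro x hx
    rw [tsum_eq_sum (s := Finset.range (firstReturn T A x))]
    · rw [Finset.sum_congr rfl (g := fun _ => (1 : ℝ≥0∞))]
      · simp
      · intro k hk
        have : T x ∈ avoid T A k := (lt_firstReturn_iff hx k).1 (Finset.mem_range.1 hk)
        simp [this]
    · intro k hk
      have : T x ∉ avoid T A k := fun h => hk (Finset.mem_range.2 ((lt_firstReturn_iff hx k).2 h))
      simp [this]
  rw [lintegral_congr_ae (ae_restrict_of_ae ((ae_mem_returning hT hA h0).mono hcount)),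
    lintegral_tsum fun k => ((measurable_one.indicator (hT.measurable (hav k))).aemeasurable)]
  have hstep : ∀ k, ∫⁻ x in A, (T ⁻¹' avoid T A k).indicator 1 x ∂μ + μ (avoid T A (k + 1))
      = μ (avoid T A k) := by
    intro k
    rw [lintegral_indicator_one (hT.measurable (hav k)),
      Measure.restrict_apply (hT.measurable (hav k)), avoid_succ,
      measure_inter_add_sdiff _ hA, hT.measure_preimage (hav k).nullMeasurableSet]
  have hsum : ∀ N, ∑ k ∈ Finset.range N, ∫⁻ x in A, (T ⁻¹' avoid T A k).indicator 1 x ∂μ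
      + μ (avoid T A N) = 1 := by
    intro N
    induction N with
    | zero => simp [avoid]
    | succ N ih => rw [Finset.sum_range_succ, add_assoc, hstep, ih]
  have hlim : Tendsto (fun N => μ (avoid T A N)) atTop (𝓝 0) := by
    rw [← measure_iInter_avoid hT hA h0]
    exact tendsto_measure_iInter_atTop (fun k => (hav k).nullMeasurableSet)
      (fun a b hab x hx i hi => hx i (hi.trans_le hab)) ⟨0, measure_ne_top _ _⟩
  have h1 := (ENNReal.tendsto_nat_tsum
    fun k => ∫⁻ x in A, (T ⁻¹' avoid T A k).indicator 1 x ∂μ).add hlim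
  simp only [hsum, add_zero] at h1
  exact (tendsto_nhds_unique tendsto_const_nhds h1).symm

/-! ### Moments of the return time -/

lemma lintegral_firstReturn_rpow_le (hT : Ergodic T μ) (hA : MeasurableSet A) (h0 : μ A ≠ 0)
    {q : ℝ} (hq0 : 0 < q) (hq1 : q < 1) :
    ∫⁻ x in A, (firstReturn T A x : ℝ≥0∞) ^ (1 - q) ∂μ ≤ μ A ^ q := by
  have hm : Measurable fun x => (firstReturn T A x : ℝ≥0∞) :=
    (measurable_of_countable _).comp (measurable_firstReturn hT.measurable hA)
  have h := ENNReal.lintegral_mul_norm_pow_le (μ := μ.restrict A) hm.aemeasurable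
    (aemeasurable_const (b := (1 : ℝ≥0∞))) (sub_nonneg.2 hq1.le) hq0.le (sub_add_cancel 1 q)
  rw [lintegral_firstReturn hT hA h0] at h
  simpa using h

lemma rpow_le_lintegral_firstReturn_of_neg (hT : Ergodic T μ) (hA : MeasurableSet A)
    (h0 : μ A ≠ 0) {q : ℝ} (hq : q < 0) :
    μ A ^ q ≤ ∫⁻ x in A, (firstReturn T A x : ℝ≥0∞) ^ (1 - q) ∂μ := by
  have hm : Measurable fun x => (firstReturn T A x : ℝ≥0∞) :=
    (measurable_of_countable _).comp (measurable_firstReturn hT.measurable hA)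
  have hpos : 0 < 1 - q := by linarith
  have h := ENNReal.lintegral_mul_norm_pow_le (μ := μ.restrict A)
    (hm.pow_const (1 - q)).aemeasurable
    (aemeasurable_const (b := (1 : ℝ≥0∞))) (p := (1 - q)⁻¹) (q := -q / (1 - q)) (by positivity)
    (div_nonneg (by linarith) hpos.le) (by field_simp; ring)
  simp only [ENNReal.one_rpow, mul_one, ← ENNReal.rpow_mul, mul_inv_cancel₀ hpos.ne',
    ENNReal.rpow_one, lintegral_firstReturn hT hA h0, lintegral_const, one_mul,
    Measure.restrict_apply_univ] at h
  have h' := ENNReal.rpow_le_rpow h hpos.le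
  rw [ENNReal.one_rpow, ENNReal.mul_rpow_of_nonneg _ _ hpos.le, ← ENNReal.rpow_mul,
    ← ENNReal.rpow_mul, inv_mul_cancel₀ hpos.ne', ENNReal.rpow_one, div_mul_cancel₀ _ hpos.ne'] at h'
  calc μ A ^ q = μ A ^ q * 1 := (mul_one _).symm
    _ ≤ μ A ^ q * ((∫⁻ x in A, (firstReturn T A x : ℝ≥0∞) ^ (1 - q) ∂μ) * μ A ^ (-q)) := by gcongr
    _ = _ := by
      rw [mul_left_comm, ← ENNReal.rpow_add _ _ h0 (measure_ne_top _ _)]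
      simp

lemma rpow_le_lintegral_firstReturn_of_one_lt (hT : Ergodic T μ) (hA : MeasurableSet A)
    (h0 : μ A ≠ 0) {q : ℝ} (hq : 1 < q) :
    μ A ^ q ≤ ∫⁻ x in A, (firstReturn T A x : ℝ≥0∞) ^ (1 - q) ∂μ := by
  have hm : Measurable fun x => (firstReturn T A x : ℝ≥0∞) :=
    (measurable_of_countable _).comp (measurable_firstReturn hT.measurable hA)
  have hpos : 0 < q := by linarith
  have h := ENNReal.lintegral_mul_norm_pow_le (μ := μ.restrict A) hm.aemeasurable
    (hm.pow_const (1 - q)).aemeasurable (p := (q - 1) / q) (q := q⁻¹)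
    (div_nonneg (by linarith) hpos.le) (by positivity) (by field_simp; ring)
  have hone : ∫⁻ x in A, (firstReturn T A x : ℝ≥0∞) ^ ((q - 1) / q)
      * ((firstReturn T A x : ℝ≥0∞) ^ (1 - q)) ^ q⁻¹ ∂μ = μ A := by
    rw [lintegral_congr_ae (g := fun _ => 1), setLIntegral_one]
    refine ae_restrict_of_ae ((ae_mem_returning hT hA h0).mono fun x hx => ?_)
    have : (firstReturn T A x : ℝ≥0∞) ≠ 0 := by exact_mod_cast (firstReturn_pos hx).ne'
    change (firstReturn T A x : ℝ≥0∞) ^ ((q - 1) / q)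
      * ((firstReturn T A x : ℝ≥0∞) ^ (1 - q)) ^ q⁻¹ = 1
    rw [← ENNReal.rpow_mul, ← ENNReal.rpow_add _ _ this (ENNReal.natCast_ne_top _),
      show (q - 1) / q + (1 - q) * q⁻¹ = 0 by field_simp; ring, ENNReal.rpow_zero]
  rw [hone, lintegral_firstReturn hT hA h0, ENNReal.one_rpow, one_mul] at h
  have h' := ENNReal.rpow_le_rpow h hpos.le
  rwa [← ENNReal.rpow_mul, inv_mul_cancel₀ hpos.ne', ENNReal.rpow_one] at h'

lemma mul_log_le_integral_log_inv_firstReturn (hT : Ergodic T μ) (hA : MeasurableSet A) :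
    (μ A).toReal * Real.log (μ A).toReal
      ≤ ∫ x in A, Real.log ((firstReturn T A x : ℝ))⁻¹ ∂μ := by
  by_cases h0 : μ A = 0
  · simp [h0, Measure.restrict_eq_zero.2 h0]
  have hp : 0 < (μ A).toReal := ENNReal.toReal_pos h0 (measure_ne_top _ _)
  have hm := measurable_firstReturn hT.measurable hA
  have hkac := lintegral_firstReturn hT hA h0
  have hint : Integrable (fun x => (firstReturn T A x : ℝ)) (μ.restrict A) := by
    simpa using integrable_toReal_of_lintegral_ne_top (μ := μ.restrict A)
      (f := fun x => (firstReturn T A x : ℝ≥0∞))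
      ((measurable_of_countable _).comp hm).aemeasurable (by rw [hkac]; simp)
  have hval : ∫ x in A, (firstReturn T A x : ℝ) ∂μ = 1 := by
    have := integral_toReal (μ := μ.restrict A) (f := fun x => (firstReturn T A x : ℝ≥0∞))
      ((measurable_of_countable _).comp hm).aemeasurable (by simp)
    rw [hkac] at this
    simpa using this
  have hlogint : Integrable (fun x => Real.log ((firstReturn T A x : ℝ))⁻¹) (μ.restrict A) := by
    refine hint.mono' ?_ (ae_of_all _ fun x => ?_)
    · exact ((measurable_of_countable fun k : ℕ => Real.log ((k : ℝ))⁻¹).comp hm).aestronglyMeasurable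
    · rw [Real.log_inv, norm_neg, Real.norm_of_nonneg (Real.log_natCast_nonneg _)]
      exact Real.log_le_self (Nat.cast_nonneg _)
  have hle : ∫ x in A, (Real.log (μ A).toReal + 1 - (μ A).toReal * firstReturn T A x) ∂μ
      ≤ ∫ x in A, Real.log ((firstReturn T A x : ℝ))⁻¹ ∂μ := by
    refine integral_mono_ae ((integrable_const _).sub (hint.const_mul _)) hlogint
      (ae_restrict_of_ae ((ae_mem_returning hT hA h0).mono fun x hx => ?_))
    have hτ : (0 : ℝ) < firstReturn T A x := by exact_mod_cast firstReturn_pos hx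
    have := Real.log_le_sub_one_of_pos (mul_pos hp hτ)
    rw [Real.log_mul hp.ne' hτ.ne'] at this
    change _ ≤ Real.log ((firstReturn T A x : ℝ))⁻¹
    rw [Real.log_inv]
    change Real.log (μ A).toReal + 1 - (μ A).toReal * firstReturn T A x ≤ _
    linarith
  rw [integral_sub (integrable_const _) (hint.const_mul _), integral_const_mul, hval] at hle
  simp only [integral_const, smul_eq_mul, measureReal_def, Measure.restrict_apply_univ] at hle
  linarith

end Kac

/-! ### Monotonicity of the scaling exponents -/

lemma elog_mono : Monotone elog := by
  intro x y hxy
  unfold elog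
  split_ifs with h1 h2 h3 h4 h5 h6 h7 <;> simp_all
  exact Real.log_le_log (ENNReal.toReal_pos h1 ‹_›) (ENNReal.toReal_mono ‹_› hxy)

lemma dimScale_mono_of_lt_one {F G : ℝ → ℝ≥0∞} {q ε : ℝ} (hq : q < 1) (hε : 0 < ε) (hε1 : ε < 1)
    (h : F ε ≤ G ε) : dimScale F q ε ≤ dimScale G q ε := by
  have hc : 0 ≤ ((q - 1) * Real.log ε)⁻¹ :=
    inv_nonneg.2 (mul_nonneg_of_nonpos_of_nonpos (by linarith) (Real.log_neg hε hε1).le)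
  exact mul_le_mul_of_nonneg_left (elog_mono h) (EReal.coe_nonneg.2 hc)

lemma dimScale_anti_of_one_lt {F G : ℝ → ℝ≥0∞} {q ε : ℝ} (hq : 1 < q) (hε : 0 < ε) (hε1 : ε < 1)
    (h : F ε ≤ G ε) : dimScale G q ε ≤ dimScale F q ε := by
  have hc : 0 ≤ -((q - 1) * Real.log ε)⁻¹ :=
    neg_nonneg.2 (inv_nonpos.2 (mul_nonpos_of_nonneg_of_nonpos (by linarith)
      (Real.log_neg hε hε1).le))
  have := mul_le_mul_of_nonneg_left (elog_mono h) (EReal.coe_nonneg.2 hc)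
  rwa [EReal.coe_neg, EReal.neg_mul, EReal.neg_mul, EReal.neg_le_neg_iff] at this

lemma eventually_mem_Ioo_nhdsGT_zero {a : ℝ} (ha : 0 < a) : ∀ᶠ ε in 𝓝[>] (0 : ℝ), 0 < ε ∧ ε < a :=
  Ioo_mem_nhdsGT ha

/-! ### Geometry of the boxes -/

namespace Grid

variable {n : ℕ} (θ : Grid n)

lemma continuous_coords : Continuous θ.coords := by
  unfold coords
  fun_prop

lemma measurableSet_box (ε : ℝ) (j : Fin n → ℤ) : MeasurableSet (θ.box ε j) := by
  have : ∀ i, Measurable fun x => θ.coords x i :=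
    fun i => ((continuous_apply i).comp θ.continuous_coords).measurable
  simp only [box, ofPred_forall, ofPred_and]
  exact MeasurableSet.iInter fun i => (measurableSet_le measurable_const (this i)).inter
    (measurableSet_lt (this i) measurable_const)

lemma pairwise_disjoint_box {ε : ℝ} (hε : 0 < ε) : Pairwise (Function.onFun Disjoint (θ.box ε)) := by
  intro j k hjk
  refine Set.disjoint_left.2 fun x hj hk => hjk ?_
  have key : ∀ a b : ℤ, (a : ℝ) * ε < ((b : ℝ) + 1) * ε → a ≤ b := by
    intro a b h
    have := lt_of_mul_lt_mul_right h hε.le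
    exact Int.lt_add_one_iff.1 (by exact_mod_cast this)
  funext i
  exact le_antisymm (key _ _ ((hj i).1.trans_lt (hk i).2)) (key _ _ ((hk i).1.trans_lt (hj i).2))

/-- Boxes of positive measure belong to a finite family whose cardinality grows polynomially. -/
lemma exists_finset_box {μ : Measure (Euc n)} {X : Set (Euc n)} (hX : IsCompact X)
    (hμX : μ Xᶜ = 0) : ∃ K : ℝ, 1 ≤ K ∧ ∀ ε : ℝ, 0 < ε → ε < 1 → ∃ S : Finset (Fin n → ℤ),
      (∀ j ∉ S, μ (θ.box ε j) = 0) ∧ (S.card : ℝ) ≤ (K / ε) ^ n := by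
  obtain ⟨R, hR0, hR⟩ : ∃ R : ℝ, 0 < R ∧ ∀ x ∈ X, ∀ i, |θ.coords x i| ≤ R := by
    obtain ⟨R, hR0, hR⟩ := (hX.image θ.continuous_coords).isBounded.exists_pos_norm_le
    exact ⟨R, hR0, fun x hx i => (norm_le_pi_norm _ i).trans (hR _ (mem_image_of_mem _ hx))⟩
  refine ⟨2 * R + 4, by linarith, fun ε hε hε1 => ?_⟩
  set M : ℤ := ⌈R / ε⌉ with hM
  have hMle : R / ε ≤ M := Int.le_ceil _
  have hMlt : (M : ℝ) < R / ε + 1 := Int.ceil_lt_add_one _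
  have hRM : R ≤ M * ε := (div_le_iff₀ hε).1 hMle
  refine ⟨Fintype.piFinset fun _ => Finset.Icc (-M - 1) M, fun j hj => ?_, ?_⟩
  · refine measure_mono_null (fun x hx => ?_) hμX
    refine fun hxX => hj ?_
    rw [Fintype.mem_piFinset]
    intro i
    obtain ⟨hl, hu⟩ := hx i
    obtain ⟨h1, h2⟩ := abs_le.1 (hR x hxX i)
    rw [Finset.mem_Icc]
    constructor
    · have : (-M : ℝ) < j i + 1 := lt_of_mul_lt_mul_right (by linarith : -M * ε < (j i + 1) * ε) hε.le
      have : -M < j i + 1 := by exact_mod_cast this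
      omega
    · have : (j i : ℝ) ≤ M := le_of_mul_le_mul_right (by linarith) hε
      exact_mod_cast this
  · have hM0 : 0 ≤ M := by
      have : (0 : ℝ) ≤ M := le_trans (by positivity) hMle
      exact_mod_cast this
    have hc : ((Finset.Icc (-M - 1) M).card : ℝ) = 2 * M + 2 := by
      rw [Int.card_Icc]
      have : ((M + 1 - (-M - 1)).toNat : ℤ) = 2 * M + 2 := by omega
      exact_mod_cast this
    rw [Fintype.card_piFinset_const, Nat.cast_pow, hc]
    refine pow_le_pow_left₀ (by positivity) ?_ n
    have : 4 ≤ 4 / ε := (le_div_iff₀ hε).2 (by linarith)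
    rw [add_div, mul_div_assoc]
    linarith

end Grid

/-! ### Comparison of the box partition functions -/

section Comparison

variable {n : ℕ} {T : Euc n → Euc n} {μ : Measure (Euc n)} [IsProbabilityMeasure μ]

lemma boxRetPF_zero (hT : Ergodic T μ) (θ : Grid n) (ε : ℝ) :
    boxRetPF T μ θ ε 0 = boxMeasPF μ θ ε 0 := by
  refine tsum_congr fun j => ?_
  split_ifs with h0
  · exact setLIntegral_measure_zero _ _ h0
  · simpa using lintegral_firstReturn hT (θ.measurableSet_box ε j) h0

lemma boxRetPF_le (hT : Ergodic T μ) (θ : Grid n) (ε : ℝ) {q : ℝ} (hq0 : 0 < q) (hq1 : q < 1) :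
    boxRetPF T μ θ ε q ≤ boxMeasPF μ θ ε q := by
  refine ENNReal.tsum_le_tsum fun j => ?_
  split_ifs with h0
  · exact (setLIntegral_measure_zero _ _ h0).le
  · exact lintegral_firstReturn_rpow_le hT (θ.measurableSet_box ε j) h0 hq0 hq1

lemma boxMeasPF_le (hT : Ergodic T μ) (θ : Grid n) (ε : ℝ) {q : ℝ} (hq : q < 0 ∨ 1 < q) :
    boxMeasPF μ θ ε q ≤ boxRetPF T μ θ ε q := by
  refine ENNReal.tsum_le_tsum fun j => ?_
  split_ifs with h0
  · exact zero_le
  · rcases hq with hq | hq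
    · exact rpow_le_lintegral_firstReturn_of_neg hT (θ.measurableSet_box ε j) h0 hq
    · exact rpow_le_lintegral_firstReturn_of_one_lt hT (θ.measurableSet_box ε j) h0 hq

lemma boxRetPFlog_nonpos (T : Euc n → Euc n) (μ : Measure (Euc n)) (θ : Grid n) (ε : ℝ) :
    boxRetPFlog T μ θ ε ≤ 0 := by
  refine tsum_nonpos fun j => integral_nonpos fun x => ?_
  simpa using Real.log_natCast_nonneg (firstReturn T (θ.box ε j) x)

lemma boxMeasPFlog_le (hT : Ergodic T μ) (θ : Grid n) {ε : ℝ} {S : Finset (Fin n → ℤ)}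
    (hS : ∀ j ∉ S, μ (θ.box ε j) = 0) : boxMeasPFlog μ θ ε ≤ boxRetPFlog T μ θ ε := by
  unfold boxMeasPFlog boxRetPFlog
  rw [tsum_eq_sum (s := S) fun j hj => by simp [hS j hj],
    tsum_eq_sum (s := S) fun j hj => setIntegral_measure_zero _ (hS j hj)]
  exact Finset.sum_le_sum fun j _ =>
    mul_log_le_integral_log_inv_firstReturn hT (θ.measurableSet_box ε j)

/-- The entropy of the grid partition is at most logarithmic in the number of charged boxes. -/
lemma neg_boxMeasPFlog_le (μ : Measure (Euc n)) [IsProbabilityMeasure μ] (θ : Grid n) {ε N : ℝ}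
    (hε : 0 < ε) {S : Finset (Fin n → ℤ)} (hS : ∀ j ∉ S, μ (θ.box ε j) = 0)
    (hN1 : 1 ≤ N) (hN : (S.card : ℝ) ≤ N) :
    -boxMeasPFlog μ θ ε ≤ Real.log N + 1 := by
  have hN0 : 0 < N := by linarith
  unfold boxMeasPFlog
  rw [tsum_eq_sum (s := S) fun j hj => by simp [hS j hj], ← Finset.sum_neg_distrib]
  have hterm : ∀ p : ℝ, 0 ≤ p → -(p * Real.log p) ≤ p * Real.log N + 1 / N := by
    intro p hp
    rcases hp.eq_or_lt with rfl | hp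
    · simpa using hN0.le
    have h := mul_le_mul_of_nonneg_left
      (Real.log_le_sub_one_of_pos (inv_pos.2 (mul_pos hp hN0))) hp.le
    rw [Real.log_inv, Real.log_mul hp.ne' hN0.ne'] at h
    have : p * ((p * N)⁻¹ - 1) = 1 / N - p := by field_simp
    rw [this] at h
    linarith
  have hsum : ∑ j ∈ S, (μ (θ.box ε j)).toReal ≤ 1 := by
    have := sum_measureReal_le_measureReal_univ (μ := μ) (s := S)
      (fun j _ => θ.measurableSet_box ε j)
      (fun j _ k _ hjk => θ.pairwise_disjoint_box hε hjk)
    simpa [measureReal_def] using this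
  calc ∑ j ∈ S, -((μ (θ.box ε j)).toReal * Real.log (μ (θ.box ε j)).toReal)
      ≤ ∑ j ∈ S, ((μ (θ.box ε j)).toReal * Real.log N + 1 / N) :=
        Finset.sum_le_sum fun j _ => hterm _ ENNReal.toReal_nonneg
    _ = (∑ j ∈ S, (μ (θ.box ε j)).toReal) * Real.log N + S.card / N := by
        rw [Finset.sum_add_distrib, Finset.sum_mul, Finset.sum_const, nsmul_eq_mul, mul_one_div]
    _ ≤ 1 * Real.log N + 1 := by
        gcongr
        · exact Real.log_nonneg hN1
        · exact (div_le_one hN0).2 hN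
    _ = Real.log N + 1 := by rw [one_mul]

lemma exists_boxMeasPFlog_div_log_le {X : Set (Euc n)} (hX : IsCompact X) (hμX : μ Xᶜ = 0)
    (θ : Grid n) : ∃ C, ∀ᶠ ε in 𝓝[>] (0 : ℝ), boxMeasPFlog μ θ ε / Real.log ε ≤ C := by
  obtain ⟨K, hK1, hK⟩ := θ.exists_finset_box hX hμX
  refine ⟨n * Real.log K + 1 + n, (eventually_mem_Ioo_nhdsGT_zero (Real.exp_pos (-1))).mono ?_⟩
  rintro ε ⟨hε, hε1⟩
  have hL : Real.log ε < -1 := (Real.log_lt_iff_lt_exp hε).2 hε1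
  have hε1' : ε < 1 := hε1.trans (Real.exp_lt_one_iff.2 (by norm_num))
  obtain ⟨S, hS, hcard⟩ := hK ε hε hε1'
  have hN1 : 1 ≤ (K / ε) ^ n := one_le_pow₀ ((one_le_div hε).2 (by linarith))
  have h := neg_boxMeasPFlog_le μ θ hε hS hN1 hcard
  rw [Real.log_pow, Real.log_div (by linarith) hε.ne'] at h
  rw [← neg_div_neg_eq, div_le_iff₀ (by linarith)]
  have hlogK : 0 ≤ n * Real.log K + 1 :=
    add_nonneg (mul_nonneg (Nat.cast_nonneg n) (Real.log_nonneg hK1)) zero_le_one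
  nlinarith

/-- The logarithmic scaling ratio of the return times is dominated by that of the measure, and
both stay in a bounded interval. -/
lemma eventually_boxRetPFlog_div_log_le {X : Set (Euc n)} (hX : IsCompact X) (hμX : μ Xᶜ = 0)
    (hT : Ergodic T μ) (θ : Grid n) : ∀ᶠ ε in 𝓝[>] (0 : ℝ),
      0 ≤ boxRetPFlog T μ θ ε / Real.log ε ∧
        boxRetPFlog T μ θ ε / Real.log ε ≤ boxMeasPFlog μ θ ε / Real.log ε := by
  obtain ⟨K, -, hK⟩ := θ.exists_finset_box hX hμX
  refine (eventually_mem_Ioo_nhdsGT_zero one_pos).mono fun ε hε => ?_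
  have hL := (Real.log_neg hε.1 hε.2).le
  obtain ⟨S, hS, -⟩ := hK ε hε.1 hε.2
  exact ⟨div_nonneg_of_nonpos (boxRetPFlog_nonpos T μ θ ε) hL,
    div_le_div_of_nonpos_of_le hL (boxMeasPFlog_le hT θ hS)⟩

lemma delta_one_le {X : Set (Euc n)} (hX : IsCompact X) (hμX : μ Xᶜ = 0)
    (hT : Ergodic T μ) (θ : Grid n) :
    DeltaTauPlus T μ θ 1 ≤ DeltaMuPlus μ θ 1 ∧ DeltaTauMinus T μ θ 1 ≤ DeltaMuMinus μ θ 1 := by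
  have hev := eventually_boxRetPFlog_div_log_le hX hμX hT θ
  obtain ⟨C, hC⟩ := exists_boxMeasPFlog_div_log_le hX hμX θ
  have hle := hev.mono fun ε h => h.2
  have hτ : IsBoundedUnder (· ≥ ·) (𝓝[>] (0 : ℝ)) fun ε => boxRetPFlog T μ θ ε / Real.log ε :=
    isBoundedUnder_of_eventually_ge (hev.mono fun ε h => h.1)
  have hμ : IsBoundedUnder (· ≤ ·) (𝓝[>] (0 : ℝ)) fun ε => boxMeasPFlog μ θ ε / Real.log ε :=
    isBoundedUnder_of_eventually_le hC
  simp only [DeltaTauPlus, DeltaMuPlus, DeltaTauMinus, DeltaMuMinus, dimPlus, dimMinus, if_true,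
    EReal.coe_le_coe_iff]
  exact ⟨limsup_le_limsup hle hτ.isCoboundedUnder_le hμ,
    liminf_le_liminf hle hτ hμ.isCoboundedUnder_ge⟩

end Comparison

/-- For an ergodic dynamical system and any grid `θ`, the box dimensions
satisfy `Δ_τ^± ≥ Δ_μ^±` for `q < 0`, `Δ_τ^± ≤ Δ_μ^±` for `q > 0`, and
`Δ_τ^±(θ,0) = Δ_μ^±(θ,0)`. -/
theorem box_dimension_inequalities {n : ℕ} (T : Euc n → Euc n)
    (μ : Measure (Euc n)) [IsProbabilityMeasure μ] (X : Set (Euc n))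
    (hXc : IsCompact X) (hX1 : μ X = 1) (hTX : Set.MapsTo T X X)
    (hErg : Ergodic T μ) :
    ∀ θ : Grid n,
      (∀ q : ℝ, q < 0 →
        DeltaMuPlus μ θ q ≤ DeltaTauPlus T μ θ q ∧
          DeltaMuMinus μ θ q ≤ DeltaTauMinus T μ θ q) ∧
      (∀ q : ℝ, 0 < q →
        DeltaTauPlus T μ θ q ≤ DeltaMuPlus μ θ q ∧
          DeltaTauMinus T μ θ q ≤ DeltaMuMinus μ θ q) ∧
      (DeltaTauPlus T μ θ 0 = DeltaMuPlus μ θ 0 ∧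
        DeltaTauMinus T μ θ 0 = DeltaMuMinus μ θ 0) := by
  intro θ
  have hμX : μ Xᶜ = 0 := (prob_compl_eq_zero_iff hXc.measurableSet).2 hX1
  have hsmall := eventually_mem_Ioo_nhdsGT_zero one_pos
  refine ⟨fun q hq => ?_, fun q hq => ?_, ?_⟩
  · have hle : ∀ᶠ ε in 𝓝[>] (0 : ℝ), dimScale (fun ε => boxMeasPF μ θ ε q) q ε
        ≤ dimScale (fun ε => boxRetPF T μ θ ε q) q ε := hsmall.mono fun ε hε =>
      dimScale_mono_of_lt_one (by linarith) hε.1 hε.2 (boxMeasPF_le hErg θ ε (Or.inl hq))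
    have hq1 : q ≠ 1 := by linarith
    simp only [DeltaTauPlus, DeltaMuPlus, DeltaTauMinus, DeltaMuMinus, dimPlus, dimMinus, hq1,
      if_false]
    exact ⟨limsup_le_limsup hle, liminf_le_liminf hle⟩
  · by_cases hq1 : q = 1
    · subst hq1
      exact delta_one_le hXc hμX hErg θ
    have hle : ∀ᶠ ε in 𝓝[>] (0 : ℝ), dimScale (fun ε => boxRetPF T μ θ ε q) q ε
        ≤ dimScale (fun ε => boxMeasPF μ θ ε q) q ε := hsmall.mono fun ε hε => by
      rcases lt_or_gt_of_ne hq1 with h | h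
      · exact dimScale_mono_of_lt_one h hε.1 hε.2 (boxRetPF_le hErg θ ε hq h)
      · exact dimScale_anti_of_one_lt h hε.1 hε.2 (boxMeasPF_le hErg θ ε (Or.inr h))
    simp only [DeltaTauPlus, DeltaMuPlus, DeltaTauMinus, DeltaMuMinus, dimPlus, dimMinus, hq1,
      if_false]
    exact ⟨limsup_le_limsup hle, liminf_le_liminf hle⟩
  · simp only [DeltaTauPlus, DeltaMuPlus, DeltaTauMinus, DeltaMuMinus, dimPlus, dimMinus,
      boxRetPF_zero hErg θ, zero_ne_one, if_false, and_self]
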